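/- Fix v > 0 and let F₀(t) = ∫∫ ρ_sc(x) ρ_sc(y) e^{−t(x−y)²} dx dy, with both integrals over [−2√v, 2√v]. Then F₀ exhibits t^{−1/2} algebraic relaxation: lim_{t→∞} √t · F₀(t) = 8/(3 π^{3/2} √v). -/

import Mathlib

open Real Filter

/-- The semicircle density `ρ_sc(x) = (1/(2πv))√(4v − x²)` on `[−2√v, 2√v]`. -/
noncomputable def scDensity (v x : ℝ) : ℝ := (1 / (2 * π * v)) * Real.sqrt (4 * v - x ^ 2)

lemma scD_cont (v : ℝ) : Continuous (scDensity v) := by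
  unfold scDensity
  fun_prop

lemma scD_nonneg (v : ℝ) (hv : 0 < v) (x : ℝ) : 0 ≤ scDensity v x := by
  unfold scDensity
  positivity

lemma scD_le (v : ℝ) (hv : 0 < v) (x : ℝ) : scDensity v x ≤ scDensity v 0 := by
  unfold scDensity
  apply mul_le_mul_of_nonneg_left _ (by positivity)
  apply Real.sqrt_le_sqrt
  nlinarith [sq_nonneg x]

lemma scD_norm (v : ℝ) (hv : 0 < v) (x : ℝ) : ‖scDensity v x‖ ≤ scDensity v 0 := by
  rw [Real.norm_of_nonneg (scD_nonneg v hv x)]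
  exact scD_le v hv x

lemma scD_rescale (v : ℝ) (hv : 0 < v) (x t : ℝ) (ht : 0 < t) :
    Real.sqrt t * ∫ y in (-(2 * Real.sqrt v))..(2 * Real.sqrt v),
            scDensity v y * Real.exp (-t * (x - y) ^ 2)
      = ∫ u, scDensity v (x + u / Real.sqrt t) * Real.exp (-1 * u ^ 2) := by
  rw [intervalIntegral.integral_eq_integral_of_support_subset]
  · have h1 := MeasureTheory.Measure.integral_comp_div
      (fun u => scDensity v (x + u) * Real.exp (-t * (x - (x + u)) ^ 2)) (Real.sqrt t)
    have h2 := MeasureTheory.integral_add_left_eq_self (μ := MeasureTheory.volume)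
      (fun y => scDensity v y * Real.exp (-t * (x - y) ^ 2)) x
    rw [h2, abs_of_nonneg (Real.sqrt_nonneg t), smul_eq_mul] at h1
    rw [← h1]
    congr 1
    ext u
    congr 2
    have hs : Real.sqrt t ^ 2 = t := Real.sq_sqrt ht.le
    have : x - (x + u / Real.sqrt t) = -(u / Real.sqrt t) := by ring
    rw [this, neg_sq, div_pow, hs]
    field_simp
  · intro y hy
    have h : scDensity v y ≠ 0 := left_ne_zero_of_mul hy
    unfold scDensity at h
    have h' : Real.sqrt (4 * v - y ^ 2) ≠ 0 := right_ne_zero_of_mul h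
    have hp : 0 < 4 * v - y ^ 2 := by
      by_contra hc
      exact h' (Real.sqrt_eq_zero_of_nonpos (not_lt.mp hc))
    have hs : Real.sqrt v ^ 2 = v := Real.sq_sqrt hv.le
    have := abs_lt.mp (abs_lt_of_sq_lt_sq (a := y) (b := 2 * Real.sqrt v) (by nlinarith)
      (by positivity))
    exact ⟨this.1, this.2.le⟩

lemma scD_bound (v : ℝ) (hv : 0 < v) (x s : ℝ) :
    ‖∫ u, scDensity v (x + u / s) * Real.exp (-1 * u ^ 2)‖ ≤ scDensity v 0 * Real.sqrt π := by
  have hg : MeasureTheory.Integrable (fun u : ℝ => scDensity v 0 * Real.exp (-1 * u ^ 2)) :=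
    (integrable_exp_neg_mul_sq one_pos).const_mul _
  refine (MeasureTheory.norm_integral_le_of_norm_le hg (.of_forall fun u => ?_)).trans ?_
  · rw [norm_mul, Real.norm_of_nonneg (Real.exp_pos _).le]
    exact mul_le_mul_of_nonneg_right (scD_norm v hv _) (Real.exp_pos _).le
  · rw [MeasureTheory.integral_const_mul, integral_gaussian, div_one]

lemma scD_lim (v : ℝ) (hv : 0 < v) (x : ℝ) :
    Tendsto (fun t : ℝ => ∫ u, scDensity v (x + u / Real.sqrt t) * Real.exp (-1 * u ^ 2))
      atTop (nhds (scDensity v x * Real.sqrt π)) := by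
  have hg : MeasureTheory.Integrable (fun u : ℝ => scDensity v 0 * Real.exp (-1 * u ^ 2)) :=
    (integrable_exp_neg_mul_sq one_pos).const_mul _
  have e : scDensity v x * Real.sqrt π = ∫ u : ℝ, scDensity v x * Real.exp (-1 * u ^ 2) := by
    rw [MeasureTheory.integral_const_mul, integral_gaussian, div_one]
  rw [e]
  have hc := scD_cont v
  refine MeasureTheory.tendsto_integral_filter_of_dominated_convergence _ ?_ ?_ hg ?_
  · exact .of_forall fun t => Continuous.aestronglyMeasurable (by fun_prop)
  · refine .of_forall fun t => .of_forall fun u => ?_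
    rw [norm_mul, Real.norm_of_nonneg (Real.exp_pos _).le]
    exact mul_le_mul_of_nonneg_right (scD_norm v hv _) (Real.exp_pos _).le
  · refine .of_forall fun u => Tendsto.mul_const _ ?_
    refine (hc.tendsto x).comp ?_
    have : Tendsto (fun t : ℝ => u / Real.sqrt t) atTop (nhds 0) :=
      tendsto_const_nhds.div_atTop Real.tendsto_sqrt_atTop
    simpa using this.const_add x

lemma scD_value (v : ℝ) (hv : 0 < v) :
    ∫ x in (-(2 * Real.sqrt v))..(2 * Real.sqrt v), scDensity v x * (scDensity v x * Real.sqrt π)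
      = 8 / (3 * π ^ ((3 : ℝ) / 2) * Real.sqrt v) := by
  have hs : Real.sqrt v ^ 2 = v := Real.sq_sqrt hv.le
  have hsp : 0 < Real.sqrt v := Real.sqrt_pos.mpr hv
  have hpp : Real.sqrt π ^ 2 = π := Real.sq_sqrt pi_pos.le
  have hp0 : 0 < Real.sqrt π := Real.sqrt_pos.mpr pi_pos
  have e : ∫ x in (-(2 * Real.sqrt v))..(2 * Real.sqrt v),
        scDensity v x * (scDensity v x * Real.sqrt π)
      = ∫ x in (-(2 * Real.sqrt v))..(2 * Real.sqrt v),
        ((1 / (2 * π * v)) ^ 2 * Real.sqrt π) * (4 * v - x ^ 2) := by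
    apply intervalIntegral.integral_congr
    intro x hx
    rw [Set.uIcc_of_le (by linarith)] at hx
    have h0 : 0 ≤ 4 * v - x ^ 2 := by nlinarith [hx.1, hx.2]
    have := Real.mul_self_sqrt h0
    simp only [scDensity]
    linear_combination ((1 / (2 * π * v)) ^ 2 * Real.sqrt π) * this
  have hr : π ^ ((3 : ℝ) / 2) = π * Real.sqrt π := by
    rw [Real.sqrt_eq_rpow, show (3 : ℝ) / 2 = 1 + 1 / 2 by norm_num, Real.rpow_add pi_pos,
      Real.rpow_one]
  rw [e, intervalIntegral.integral_const_mul, intervalIntegral.integral_sub (by simp)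
    (by apply Continuous.intervalIntegrable; fun_prop), integral_pow,
    intervalIntegral.integral_const, hr, smul_eq_mul]
  generalize Real.sqrt v = s at *
  have hpi : π = Real.sqrt π ^ 2 := hpp.symm
  generalize Real.sqrt π = p at *
  rw [hpi]
  subst hs
  push_cast
  field_simp
  ring

/-- the leading-order dissipative form factor
`F₀(t) = ∫∫ ρ_sc(x) ρ_sc(y) e^{−t(x−y)²} dx dy` of the simple dissipator with a GUE jump
operator exhibits `t^{−1/2}` relaxation: `√t · F₀(t) → 8/(3 π^{3/2} √v)`. -/
theorem gue_dissipator_form_factor_decay (v : ℝ) (hv : 0 < v) :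
    Tendsto
      (fun t : ℝ => Real.sqrt t *
        ∫ x in (-(2 * Real.sqrt v))..(2 * Real.sqrt v),
          ∫ y in (-(2 * Real.sqrt v))..(2 * Real.sqrt v),
            scDensity v x * scDensity v y * Real.exp (-t * (x - y) ^ 2))
      atTop (nhds (8 / (3 * π ^ ((3 : ℝ) / 2) * Real.sqrt v))) := by
  have hc := scD_cont v
  rw [← scD_value v hv]
  have e : ∀ t : ℝ, Real.sqrt t *
        (∫ x in (-(2 * Real.sqrt v))..(2 * Real.sqrt v),
          ∫ y in (-(2 * Real.sqrt v))..(2 * Real.sqrt v),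
            scDensity v x * scDensity v y * Real.exp (-t * (x - y) ^ 2))
      = ∫ x in (-(2 * Real.sqrt v))..(2 * Real.sqrt v), scDensity v x * (Real.sqrt t *
          ∫ y in (-(2 * Real.sqrt v))..(2 * Real.sqrt v),
            scDensity v y * Real.exp (-t * (x - y) ^ 2)) := by
    intro t
    rw [← intervalIntegral.integral_const_mul]
    congr 1
    ext x
    simp only [mul_assoc]
    rw [intervalIntegral.integral_const_mul]
    ring
  simp only [e]
  refine intervalIntegral.tendsto_integral_filter_of_dominated_convergence
    (fun _ => scDensity v 0 * (scDensity v 0 * Real.sqrt π)) ?_ ?_ (by simp) ?_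
  · refine .of_forall fun t => Continuous.aestronglyMeasurable ?_
    refine hc.mul (continuous_const.mul ?_)
    apply intervalIntegral.continuous_parametric_intervalIntegral_of_continuous'
    simp only [Function.uncurry_def]
    fun_prop
  · filter_upwards [eventually_gt_atTop 0] with t ht
    refine .of_forall fun x _ => ?_
    rw [scD_rescale v hv x t ht, norm_mul]
    exact mul_le_mul (scD_norm v hv x) (scD_bound v hv x _) (norm_nonneg _) (scD_nonneg v hv 0)
  · refine .of_forall fun x _ => Tendsto.const_mul _ ?_
    refine (scD_lim v hv x).congr' ?_
    filter_upwards [eventually_gt_atTop 0] with t ht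
    exact (scD_rescale v hv x t ht).symm
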